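/- arXiv:2302.11295 — 2 statements merged into one kernel-verified Lean document; each statement's English description precedes it below -/
import Mathlib

section
/- Let G = (A ∪ B, E) be a bipartite graph whose vertices are colored with two colors in ratio 1:1 (each color occurs on exactly half of the vertices). Then among all fair partitions of the vertex set there is one of minimum correlation clustering cost in which every part consists of exactly 2 vertices (one of each color). -/
open Finset

/-- Two vertices lie in a common block of the clustering `P`. -/
def SameBlock {V : Type*} (P : Finset (Finset V)) (u v : V) : Prop :=
  ∃ S ∈ P, u ∈ S ∧ v ∈ S

/-- Inter-cluster cost: the number of edges whose endpoints lie in different blocks of `P`. -/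
noncomputable def interCost {V : Type*} (G : SimpleGraph V) (P : Finset (Finset V)) : ℕ :=
  {e : Sym2 V | e ∈ G.edgeSet ∧ ∃ u ∈ e, ∃ v ∈ e, ¬ SameBlock P u v}.ncard

/-- Intra-cluster cost: the number of non-adjacent pairs of distinct vertices lying in a
common block of `P`. -/
noncomputable def intraCost {V : Type*} (G : SimpleGraph V) (P : Finset (Finset V)) : ℕ :=
  {e : Sym2 V | ¬ e.IsDiag ∧ e ∉ G.edgeSet ∧ ∀ u ∈ e, ∀ v ∈ e, SameBlock P u v}.ncard

/-- The correlation clustering cost of a clustering `P` on the graph `G`. -/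
noncomputable def ccCost {V : Type*} (G : SimpleGraph V) (P : Finset (Finset V)) : ℕ :=
  intraCost G P + interCost G P

/-- A set `S` is fair w.r.t. the coloring `col`: for each color, the fraction of `S`
of that color equals the global fraction (stated by cross multiplication). -/
def FairSet {V : Type*} [Fintype V] {k : ℕ} (col : V → Fin k) (S : Finset V) : Prop :=
  ∀ i : Fin k,
    (S.filter fun v => col v = i).card * Fintype.card V
      = (Finset.univ.filter fun v => col v = i).card * S.card

theorem sameBlock_self {V : Type*} [Fintype V] [DecidableEq V]
    (P : Finpartition (univ : Finset V)) (u : V) : SameBlock P.parts u u := by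
  obtain ⟨S, hS, hu⟩ := P.exists_mem (mem_univ u)
  exact ⟨S, hS, hu, hu⟩

theorem SameBlock.symm {V : Type*} {P : Finset (Finset V)} {u v : V}
    (h : SameBlock P u v) : SameBlock P v u := by
  obtain ⟨S, hS, hu, hv⟩ := h
  exact ⟨S, hS, hv, hu⟩

theorem forall_sameBlock_mk_iff {V : Type*} [Fintype V] [DecidableEq V]
    (P : Finpartition (univ : Finset V)) (x y : V) :
    (∀ u ∈ s(x, y), ∀ v ∈ s(x, y), SameBlock P.parts u v) ↔ SameBlock P.parts x y := by
  refine ⟨fun h => h x (Sym2.mem_mk_left x y) y (Sym2.mem_mk_right x y), fun h u hu v hv => ?_⟩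
  rcases Sym2.mem_iff.1 hu with rfl | rfl <;> rcases Sym2.mem_iff.1 hv with rfl | rfl
  exacts [sameBlock_self P _, h, h.symm, sameBlock_self P _]

theorem exists_not_sameBlock_mk_iff {V : Type*} [Fintype V] [DecidableEq V]
    (P : Finpartition (univ : Finset V)) (x y : V) :
    (∃ u ∈ s(x, y), ∃ v ∈ s(x, y), ¬ SameBlock P.parts u v) ↔ ¬ SameBlock P.parts x y := by
  rw [← forall_sameBlock_mk_iff]
  push Not
  rfl

/-- The partition obtained from `P` by removing the elements of `T` from all parts and adding `T`
as a part of its own. -/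
def Finpartition.splitOff {V : Type*} [Fintype V] [DecidableEq V]
    (P : Finpartition (univ : Finset V)) (T : Finset V) (hT : T.Nonempty) :
    Finpartition (univ : Finset V) :=
  (P.avoid T).extend hT.ne_empty sdiff_disjoint (sdiff_union_of_subset (subset_univ T))

theorem Finpartition.mem_splitOff {V : Type*} [Fintype V] [DecidableEq V]
    (P : Finpartition (univ : Finset V)) {T : Finset V} (hT : T.Nonempty) (R : Finset V) :
    R ∈ (P.splitOff T hT).parts ↔ R = T ∨ ∃ d ∈ P.parts, ¬ d ⊆ T ∧ d \ T = R := by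
  simp only [Finpartition.splitOff, Finpartition.extend_parts, mem_insert, Finpartition.mem_avoid]

theorem Finpartition.sameBlock_splitOff_iff {V : Type*} [Fintype V] [DecidableEq V]
    (P : Finpartition (univ : Finset V)) {S T : Finset V} (hS : S ∈ P.parts) (hTS : T ⊆ S)
    (hT : T.Nonempty) (u v : V) :
    SameBlock (P.splitOff T hT).parts u v ↔ SameBlock P.parts u v ∧ (u ∈ T ↔ v ∈ T) := by
  constructor
  · rintro ⟨R, hR, hu, hv⟩
    rcases (P.mem_splitOff hT R).1 hR with rfl | ⟨d, hd, -, rfl⟩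
    · exact ⟨⟨S, hS, hTS hu, hTS hv⟩, by simp [hu, hv]⟩
    · rw [mem_sdiff] at hu hv
      exact ⟨⟨d, hd, hu.1, hv.1⟩, by simp [hu.2, hv.2]⟩
  · rintro ⟨⟨R, hR, hu, hv⟩, h⟩
    by_cases huT : u ∈ T
    · exact ⟨T, (P.mem_splitOff hT T).2 (Or.inl rfl), huT, h.1 huT⟩
    · exact ⟨R \ T, (P.mem_splitOff hT _).2 (Or.inr ⟨R, hR, fun hRT => huT (hRT hu), rfl⟩),
        mem_sdiff.2 ⟨hu, huT⟩, mem_sdiff.2 ⟨hv, fun hvT => huT (h.2 hvT)⟩⟩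

/-- Splitting off a pair of vertices without common neighbour in its block does not increase
the cost. -/
theorem ccCost_splitOff_le {V : Type*} [Fintype V] [DecidableEq V] (G : SimpleGraph V)
    (P : Finpartition (univ : Finset V)) {S : Finset V} (hS : S ∈ P.parts) {r b : V}
    (hr : r ∈ S) (hb : b ∈ S) (hrb : ∀ w ∈ S, ¬ (G.Adj r w ∧ G.Adj b w))
    {T : Finset V} (hTrb : T = {r, b}) (hT : T.Nonempty) :
    ccCost G (P.splitOff T hT).parts ≤ ccCost G P.parts := by
  have hTS : T ⊆ S := by
    simp [hTrb, insert_subset_iff, hr, hb]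
  have hP' := P.sameBlock_splitOff_iff hS hTS hT
  set C : Set (Sym2 V) := {e | ∃ u ∈ T, ∃ w ∈ S \ T, e = s(u, w)} with hC
  have hYX : (C ∩ G.edgeSet).ncard ≤ (C \ G.edgeSet).ncard := by
    refine Set.ncard_le_ncard_of_injOn (Sym2.map (Equiv.swap r b)) ?_
      (Sym2.map.injective (Equiv.injective _)).injOn (Set.toFinite _)
    rintro _ ⟨⟨u, hu, w, hw, rfl⟩, hadj⟩
    rw [mem_sdiff] at hw
    have hwr : w ≠ r := fun h => hw.2 (by simp [hTrb, h])
    have hwb : w ≠ b := fun h => hw.2 (by simp [hTrb, h])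
    rw [SimpleGraph.mem_edgeSet] at hadj
    rw [Sym2.map_mk, Equiv.swap_apply_of_ne_of_ne hwr hwb]
    rw [hTrb, mem_insert, mem_singleton] at hu
    rcases hu with rfl | rfl
    · rw [Equiv.swap_apply_left]
      exact ⟨⟨b, by simp [hTrb], w, mem_sdiff.2 hw, rfl⟩, fun h => hrb w hw.1 ⟨hadj, h⟩⟩
    · rw [Equiv.swap_apply_right]
      exact ⟨⟨r, by simp [hTrb], w, mem_sdiff.2 hw, rfl⟩, fun h => hrb w hw.1 ⟨h, hadj⟩⟩
  have hintra : intraCost G (P.splitOff T hT).parts + (C \ G.edgeSet).ncard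
      ≤ intraCost G P.parts := by
    unfold intraCost
    rw [← Set.ncard_union_eq ?_ (Set.toFinite _) (Set.toFinite _)]
    · refine Set.ncard_le_ncard ?_ (Set.toFinite _)
      rintro e (he | he)
      · induction e with | _ x y
        simp only [Set.mem_ofPred_eq, forall_sameBlock_mk_iff] at he ⊢
        rw [hP'] at he
        exact ⟨he.1, he.2.1, he.2.2.1⟩
      · obtain ⟨⟨u, hu, w, hw, rfl⟩, hadj⟩ := he
        simp only [Set.mem_ofPred_eq, forall_sameBlock_mk_iff]
        rw [mem_sdiff] at hw
        refine ⟨?_, hadj, S, hS, hTS hu, hw.1⟩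
        rw [Sym2.mk_isDiag_iff]
        rintro rfl
        exact hw.2 hu
    · rw [Set.disjoint_left]
      rintro _ he ⟨⟨u, hu, w, hw, rfl⟩, -⟩
      simp only [Set.mem_ofPred_eq, forall_sameBlock_mk_iff] at he
      rw [hP'] at he
      exact (mem_sdiff.1 hw).2 (he.2.2.2.1 hu)
  have hinter : interCost G (P.splitOff T hT).parts
      ≤ interCost G P.parts + (C ∩ G.edgeSet).ncard := by
    unfold interCost
    refine (Set.ncard_le_ncard ?_ (Set.toFinite _)).trans (Set.ncard_union_le _ _)
    intro e he
    induction e with | _ x y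
    simp only [Set.mem_union, Set.mem_ofPred_eq, exists_not_sameBlock_mk_iff] at he ⊢
    rw [hP'] at he
    by_cases hxy : SameBlock P.parts x y
    · refine Or.inr ⟨?_, he.1⟩
      obtain ⟨R, hR, hx, hy⟩ := hxy
      have hne : ¬ (x ∈ T ↔ y ∈ T) := fun h => he.2 ⟨⟨R, hR, hx, hy⟩, h⟩
      by_cases hxT : x ∈ T
      · obtain rfl := P.eq_of_mem_parts hR hS hx (hTS hxT)
        exact ⟨x, hxT, y, mem_sdiff.2 ⟨hy, fun h => hne (iff_of_true hxT h)⟩, rfl⟩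
      · have hyT : y ∈ T := by tauto
        obtain rfl := P.eq_of_mem_parts hR hS hy (hTS hyT)
        exact ⟨y, hyT, x, mem_sdiff.2 ⟨hx, hxT⟩, Sym2.eq_swap⟩
    · exact Or.inl ⟨he.1, hxy⟩
  unfold ccCost
  omega

/-- With two colors in ratio `1:1`, a set is fair iff each color occurs on exactly half of it. -/
theorem fairSet_iff_of_ratio {V : Type*} [Fintype V] [Nonempty V] {k : ℕ} {col : V → Fin k}
    (hratio : ∀ i : Fin k, (univ.filter fun v => col v = i).card * 2 = Fintype.card V)
    (S : Finset V) :
    FairSet col S ↔ ∀ i : Fin k, (S.filter fun v => col v = i).card * 2 = S.card := by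
  refine forall_congr' fun i => ?_
  have hpos : 0 < (univ.filter fun v => col v = i).card := by
    have := hratio i
    have := Fintype.card_pos (α := V)
    omega
  rw [← hratio i, Nat.mul_left_comm, Nat.mul_left_cancel_iff hpos]

/-- A set that meets both colors contains a bichromatic pair without common neighbour in it. -/
theorem exists_pair_without_common_neighbor {V : Type*} (G : SimpleGraph V) (A : Set V)
    (hbip : ∀ u v, G.Adj u v → (u ∈ A ↔ v ∉ A)) (col : V → Fin 2) (S : Finset V)
    (hS : ∀ i : Fin 2, ∃ v ∈ S, col v = i) :
    ∃ r ∈ S, ∃ b ∈ S, col r = 0 ∧ col b = 1 ∧ ∀ w ∈ S, ¬ (G.Adj r w ∧ G.Adj b w) := by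
  by_cases h : ∃ r ∈ S, ∃ b ∈ S, col r = 0 ∧ col b = 1 ∧ ¬ (r ∈ A ↔ b ∈ A)
  · obtain ⟨r, hr, b, hb, hr0, hb1, hA⟩ := h
    refine ⟨r, hr, b, hb, hr0, hb1, fun w _ hw => hA ?_⟩
    rw [hbip r w hw.1, hbip b w hw.2]
  · push Not at h
    obtain ⟨r, hr, hr0⟩ := hS 0
    obtain ⟨b, hb, hb1⟩ := hS 1
    refine ⟨r, hr, b, hb, hr0, hb1, fun w hw hadj => ?_⟩
    have h1 := hbip r w hadj.1
    have h2 := h r hr b hb hr0 hb1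
    have hcol : col w = 0 ∨ col w = 1 := by omega
    rcases hcol with hw0 | hw1
    · have := h w hw b hb hw0 hb1
      tauto
    · have := h r hr w hw hr0 hw1
      tauto

/-- In a bipartite graph with two colors in ratio `1:1` there is a fair
partition of minimum correlation clustering cost among all fair partitions in which
every part consists of exactly 2 vertices, one of each color. -/
theorem stmt2 {V : Type*} [Fintype V] [DecidableEq V]
    (G : SimpleGraph V) (A : Set V)
    (hbip : ∀ u v, G.Adj u v → (u ∈ A ↔ v ∉ A))
    (col : V → Fin 2)
    (hratio : ∀ i : Fin 2,
      (Finset.univ.filter fun v => col v = i).card * 2 = Fintype.card V) :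
    ∃ P : Finpartition (Finset.univ : Finset V),
      (∀ S ∈ P.parts, FairSet col S) ∧
      (∀ Q : Finpartition (Finset.univ : Finset V),
        (∀ S ∈ Q.parts, FairSet col S) → ccCost G P.parts ≤ ccCost G Q.parts) ∧
      ∀ S ∈ P.parts, S.card = 2 ∧
        ∀ i : Fin 2, (S.filter fun v => col v = i).card = 1 := by
  classical
  rcases isEmpty_or_nonempty V with hV | hV
  · have hparts : ∀ (P : Finpartition (univ : Finset V)) (S : Finset V), S ∉ P.parts :=
      fun P S hS => (P.nonempty_of_mem_parts hS).ne_empty (Subsingleton.elim S ∅)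
    have hempty : ∀ P : Finpartition (univ : Finset V), P.parts = ∅ :=
      fun P => eq_empty_of_forall_notMem (hparts P)
    refine ⟨⊤, fun S hS => absurd hS (hparts _ S), fun Q _ => ?_,
      fun S hS => absurd hS (hparts _ S)⟩
    rw [hempty Q, hempty ⊤]
  have hfair := fairSet_iff_of_ratio hratio
  obtain ⟨P₀, hP₀, hmin₀⟩ := Set.exists_min_image
    {P : Finpartition (univ : Finset V) | ∀ S ∈ P.parts, FairSet col S}
    (fun P => ccCost G P.parts) (Set.toFinite _) ⟨⊤, fun S hS => by
      rw [mem_singleton.1 (Finpartition.parts_top_subset _ hS), hfair]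
      exact hratio⟩
  obtain ⟨P, ⟨hPfair, hPcost⟩, hPmin⟩ := (Set.toFinite
    {P : Finpartition (univ : Finset V) |
      (∀ S ∈ P.parts, FairSet col S) ∧ ccCost G P.parts ≤ ccCost G P₀.parts}).exists_minimal
    ⟨P₀, hP₀, le_rfl⟩
  have hcard : ∀ S ∈ P.parts, S.card = 2 := by
    intro S hS
    have hSfair := (hfair S).1 (hPfair S hS)
    have hSpos : 0 < S.card := card_pos.2 (P.nonempty_of_mem_parts hS)
    obtain ⟨r, hr, b, hb, hr0, hb1, hrb⟩ :=
      exists_pair_without_common_neighbor G A hbip col S fun i => by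
        have hi : 0 < (S.filter fun v => col v = i).card := by
          have := hSfair i
          omega
        obtain ⟨v, hv⟩ := card_pos.1 hi
        exact ⟨v, (mem_filter.1 hv).1, (mem_filter.1 hv).2⟩
    have hne : r ≠ b := by
      rintro rfl
      simp [hr0] at hb1
    have hT : ({r, b} : Finset V).Nonempty := insert_nonempty r {b}
    have hTS : ({r, b} : Finset V) ⊆ S := by
      simp [insert_subset_iff, hr, hb]
    have hTcard : ({r, b} : Finset V).card = 2 := card_pair hne
    have hTcol : ∀ i : Fin 2, (({r, b} : Finset V).filter fun v => col v = i).card = 1 := by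
      intro i
      fin_cases i <;> simp [filter_insert, filter_singleton, hr0, hb1]
    have hle : P.splitOff {r, b} hT ≤ P := by
      intro R hR
      rcases (P.mem_splitOff hT R).1 hR with rfl | ⟨d, hd, -, rfl⟩
      · exact ⟨S, hS, hTS⟩
      · exact ⟨d, hd, sdiff_subset⟩
    have hfair' : ∀ R ∈ (P.splitOff {r, b} hT).parts, FairSet col R := by
      intro R hR
      rcases (P.mem_splitOff hT R).1 hR with rfl | ⟨d, hd, -, rfl⟩
      · rw [hfair]
        intro i
        rw [hTcol, hTcard]
      · by_cases hdS : d = S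
        · subst hdS
          rw [hfair]
          intro i
          have hsdiff : (d \ {r, b}).filter (fun v => col v = i)
              = d.filter (fun v => col v = i) \ ({r, b} : Finset V).filter fun v => col v = i := by
            ext v
            simp only [mem_filter, mem_sdiff]
            tauto
          rw [card_sdiff_of_subset hTS, ← hSfair i, hTcard, hsdiff,
            card_sdiff_of_subset (filter_subset_filter _ hTS), hTcol]
          omega
        · have hdisj : Disjoint d {r, b} := (P.disjoint hd hS hdS).mono_right hTS
          rw [sdiff_eq_self_of_disjoint hdisj]
          exact hPfair d hd
    have hge := hPmin
      ⟨hfair', (ccCost_splitOff_le G P hS hr hb hrb rfl hT).trans hPcost⟩ hle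
    obtain ⟨R, hR, hSR⟩ := hge hS
    rcases (P.mem_splitOff hT R).1 hR with rfl | ⟨d, -, -, rfl⟩
    · rw [subset_antisymm hSR hTS, hTcard]
    · have := (mem_sdiff.1 (hSR hr)).2
      simp at this
  refine ⟨P, hPfair, fun Q hQ => hPcost.trans (hmin₀ Q hQ), fun S hS => ⟨hcard S hS, fun i => ?_⟩⟩
  have := (hfair S).1 (hPfair S hS) i
  rw [hcard S hS] at this
  omega
end

section
/- Let F = (V,E) be a forest with n vertices and let S ⊂ V with 4 < |S| ≤ n − 3. Then cost(F, {V}) > cost(F, {S, V∖S}), i.e., the one-cluster partition has strictly larger correlation clustering cost than the partition into S and its complement. -/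
open Finset

/-- An acyclic graph on a nonempty finite vertex type has fewer edges than vertices. -/
theorem SimpleGraph.IsAcyclic.ncard_edgeSet_add_one_le {V : Type*} [Finite V] [Nonempty V]
    {G : SimpleGraph V} (hG : G.IsAcyclic) : G.edgeSet.ncard + 1 ≤ Nat.card V := by
  obtain ⟨T, hGT, -, hT⟩ :=
    SimpleGraph.connected_top.exists_isTree_le_of_le_of_isAcyclic le_top hG
  have hcard := (SimpleGraph.isTree_iff_connected_and_card.mp hT).2
  rw [Nat.card_coe_set_eq] at hcard
  have := Set.ncard_le_ncard (SimpleGraph.edgeSet_mono hGT) (Set.toFinite _)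
  lia

theorem sameBlock_singleton_univ {V : Type*} [Fintype V] (u v : V) :
    SameBlock ({Finset.univ} : Finset (Finset V)) u v := by
  simp [SameBlock]

theorem sameBlock_pair_sdiff_iff {V : Type*} [Fintype V] [DecidableEq V] {S : Finset V} {u v : V} :
    SameBlock ({S, Finset.univ \ S} : Finset (Finset V)) u v ↔ (u ∈ S ↔ v ∈ S) := by
  simp [SameBlock]
  tauto

/-- The unordered pairs with one element in `S` and one outside of `S`. -/
def crossPairs {V : Type*} (S : Finset V) : Set (Sym2 V) :=
  {e | ∃ u ∈ e, ∃ v ∈ e, u ∈ S ∧ v ∉ S}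

theorem mk_mem_crossPairs_iff {V : Type*} {S : Finset V} {u v : V} :
    s(u, v) ∈ crossPairs S ↔ ¬ (u ∈ S ↔ v ∈ S) := by
  simp [crossPairs]
  tauto

theorem ncard_crossPairs {V : Type*} [Fintype V] [DecidableEq V] (S : Finset V) :
    (crossPairs S).ncard = S.card * (Fintype.card V - S.card) := by
  have himage : crossPairs S =
      ((S ×ˢ Sᶜ).image (fun p : V × V => s(p.1, p.2)) : Finset (Sym2 V)) := by
    ext e
    induction e with
    | _ u v =>
      simp only [mk_mem_crossPairs_iff, coe_image, Set.mem_image, mem_coe, mem_product,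
        mem_compl, Prod.exists, Sym2.eq_iff]
      grind
  rw [himage, Set.ncard_coe_finset, card_image_of_injOn, card_product, card_compl]
  rintro ⟨a, b⟩ hab ⟨c, d⟩ hcd h
  simp only [coe_product, Set.mem_prod, mem_coe, mem_compl] at hab hcd
  simp only [Sym2.eq_iff] at h
  grind

theorem interCost_singleton_univ {V : Type*} [Fintype V] (G : SimpleGraph V) :
    interCost G ({Finset.univ} : Finset (Finset V)) = 0 := by
  simp [interCost, sameBlock_singleton_univ]

theorem interCost_pair_sdiff {V : Type*} [Fintype V] [DecidableEq V] (G : SimpleGraph V)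
    (S : Finset V) :
    interCost G ({S, Finset.univ \ S} : Finset (Finset V)) =
      (crossPairs S ∩ G.edgeSet).ncard := by
  unfold interCost
  congr 1
  ext e
  induction e with
  | _ u v =>
    simp only [Set.mem_ofPred_eq, Set.mem_inter_iff, mk_mem_crossPairs_iff,
      sameBlock_pair_sdiff_iff, Sym2.mem_iff]
    grind

theorem intraCost_singleton_univ {V : Type*} [Fintype V] [DecidableEq V] (G : SimpleGraph V)
    (S : Finset V) :
    intraCost G ({Finset.univ} : Finset (Finset V)) =
      intraCost G ({S, Finset.univ \ S} : Finset (Finset V)) +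
        (crossPairs S \ G.edgeSet).ncard := by
  unfold intraCost
  rw [← Set.ncard_union_eq]
  · congr 1
    ext e
    induction e with
    | _ u v =>
      simp only [Set.mem_ofPred_eq, Set.mem_union, Set.mem_sdiff, mk_mem_crossPairs_iff,
        sameBlock_pair_sdiff_iff, sameBlock_singleton_univ, Sym2.mem_iff, Sym2.mk_isDiag_iff]
      grind
  · rw [Set.disjoint_left]
    intro e
    induction e with
    | _ u v =>
      simp only [Set.mem_ofPred_eq, Set.mem_sdiff, mk_mem_crossPairs_iff,
        sameBlock_pair_sdiff_iff, Sym2.mem_iff]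
      grind

/-- In a forest on `n` vertices, for every vertex set `S` with
`4 < |S| ≤ n - 3`, the partition `{S, V ∖ S}` has strictly smaller correlation
clustering cost than the single-cluster partition `{V}`. -/
theorem stmt15 {V : Type*} [Fintype V] [DecidableEq V]
    (F : SimpleGraph V) (hF : F.IsAcyclic)
    (S : Finset V) (h4 : 4 < S.card) (hn : S.card + 3 ≤ Fintype.card V) :
    ccCost F ({S, Finset.univ \ S} : Finset (Finset V))
      < ccCost F ({Finset.univ} : Finset (Finset V)) := by
  have : Nonempty V := Fintype.card_pos_iff.mp (by lia)
  have hedges := hF.ncard_edgeSet_add_one_le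
  rw [Nat.card_eq_fintype_card] at hedges
  have hinter : (crossPairs S ∩ F.edgeSet).ncard ≤ F.edgeSet.ncard :=
    Set.ncard_le_ncard Set.inter_subset_right (Set.toFinite _)
  have hsplit := Set.ncard_inter_add_ncard_sdiff_eq_ncard (crossPairs S) F.edgeSet
  rw [ncard_crossPairs] at hsplit
  obtain ⟨t, ht⟩ := Nat.exists_eq_add_of_le (show S.card ≤ Fintype.card V by lia)
  rw [ht, Nat.add_sub_cancel_left] at hsplit
  have hprod : 2 * (S.card + t) ≤ S.card * t + 1 := by
    have ht3 : 3 ≤ t := by lia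
    nlinarith
  simp only [ccCost, interCost_singleton_univ, interCost_pair_sdiff,
    intraCost_singleton_univ F S]
  lia
end
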